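/- arXiv:1503.08329 — 2 statements merged into one kernel-verified Lean document; each statement's English description precedes it below -/
import Mathlib

section
/- For any distribution D on X × {-1,1}, any prior distribution P on a self-complemented set H of voters f : X → [-1,1], and any δ ∈ (0,1]: with probability at least 1 − δ over the draw of S ∼ D^m, simultaneously for all posterior distributions Q aligned on P, kl(R_S(G_Q) ‖ R_D(G_Q)) ≤ (1/m)·ln(ξ(m)/δ) — i.e., the classical PAC-Bayesian bound holds with no Kullback–Leibler divergence term KL(Q‖P). -/
open MeasureTheory

/-- `kl(q‖p)`: the KL divergence between Bernoulli distributions of parameters `q`, `p`. -/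
noncomputable def klBin (q p : ℝ) : ℝ :=
  q * Real.log (q / p) + (1 - q) * Real.log ((1 - q) / (1 - p))

/-- `ξ(m) = Σ_{k=0}^m C(m,k)·(k/m)^k·(1 - k/m)^{m-k}` (with `0⁰ = 1`). -/
noncomputable def xi (m : ℕ) : ℝ :=
  ∑ k ∈ Finset.range (m + 1),
    (m.choose k : ℝ) * ((k : ℝ) / (m : ℝ)) ^ k * (1 - (k : ℝ) / (m : ℝ)) ^ (m - k)

/-- Empirical Gibbs risk (linear loss `L_ℓ(f(x),y) = (1 - y·f(x))/2`) of posterior `Q`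
on the sample `S`. -/
noncomputable def empGibbs {X ι : Type*} [MeasurableSpace ι] (F : ι → X → ℝ) {m : ℕ}
    (S : Fin m → X × ℝ) (Q : Measure ι) : ℝ :=
  ∫ i, (m : ℝ)⁻¹ * ∑ k, (1 - (S k).2 * F i (S k).1) / 2 ∂Q

/-- True Gibbs risk of posterior `Q` under `D`. -/
noncomputable def trueGibbs {X ι : Type*} [MeasurableSpace X] [MeasurableSpace ι]
    (F : ι → X → ℝ) (D : Measure (X × ℝ)) (Q : Measure ι) : ℝ :=
  ∫ i, ∫ p, (1 - p.2 * F i p.1) / 2 ∂D ∂Q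

/-- A convention-respecting `exp (m * kl(q‖p))`: it is infinite where the Bernoulli law of
parameter `q` is not absolutely continuous with respect to that of parameter `p`. -/
noncomputable def expKl (m : ℕ) (q p : ℝ) : ENNReal :=
  open Classical in
  if (p = 0 ∧ q ≠ 0) ∨ (p = 1 ∧ q ≠ 1) then ⊤ else ENNReal.ofReal (Real.exp (m * klBin q p))

/-- The linear loss of the voter `f` on the labelled example `z`. -/
noncomputable def linLoss {X : Type*} (f : X → ℝ) (z : X × ℝ) : ℝ := (1 - z.2 * f z.1) / 2

lemma klBin_one_sub (q p : ℝ) : klBin (1 - q) (1 - p) = klBin q p := by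
  simp only [klBin, sub_sub_cancel]
  ring

lemma expKl_one_sub (m : ℕ) (q p : ℝ) : expKl m (1 - q) (1 - p) = expKl m q p := by
  have h : ((1 - p = 0 ∧ 1 - q ≠ 0) ∨ (1 - p = 1 ∧ 1 - q ≠ 1)) ↔
      ((p = 0 ∧ q ≠ 0) ∨ (p = 1 ∧ q ≠ 1)) := by
    simp only [sub_eq_zero, sub_eq_self, eq_comm (a := (1 : ℝ)), ne_eq]
    tauto
  simp only [expKl, klBin_one_sub, h]

lemma measurable_expKl (m : ℕ) : Measurable fun z : ℝ × ℝ => expKl m z.1 z.2 := by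
  unfold expKl klBin
  refine Measurable.ite ?_ measurable_const (by fun_prop)
  have h1 : Measurable fun z : ℝ × ℝ => z.1 := measurable_fst
  have h2 : Measurable fun z : ℝ × ℝ => z.2 := measurable_snd
  have e (r : ℝ) : MeasurableSet {z : ℝ × ℝ | z.2 = r} := h2 (measurableSet_singleton r)
  have e' (r : ℝ) : MeasurableSet {z : ℝ × ℝ | z.1 = r} := h1 (measurableSet_singleton r)
  exact ((e 0).inter (e' 0).compl).union ((e 1).inter (e' 1).compl)

lemma one_le_xi {m : ℕ} (hm : 0 < m) : 1 ≤ xi m := by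
  have hle (k : ℕ) (hk : k ∈ Finset.range (m + 1)) :
      0 ≤ (m.choose k : ℝ) * ((k : ℝ) / (m : ℝ)) ^ k * (1 - (k : ℝ) / (m : ℝ)) ^ (m - k) := by
    have : (k : ℝ) / m ≤ 1 := by
      rw [div_le_one (by positivity)]
      exact_mod_cast Nat.lt_succ_iff.mp (Finset.mem_range.mp hk)
    have h2 : 0 ≤ 1 - (k : ℝ) / m := by linarith
    positivity
  have := Finset.single_le_sum hle (Finset.mem_range.mpr (Nat.succ_pos m))
  simpa [xi] using this

lemma pow_le_div_pow_mul_exp {m : ℕ} (hm : 0 < m) (k : ℕ) {s : ℝ} (hs : 0 ≤ s) :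
    s ^ k ≤ ((k : ℝ) / m) ^ k * Real.exp (m * s - k) := by
  rcases Nat.eq_zero_or_pos k with rfl | hk
  · simp; positivity
  have hm' : (0 : ℝ) < m := by exact_mod_cast hm
  have hk' : (0 : ℝ) < k := by exact_mod_cast hk
  have h : s ≤ (k : ℝ) / m * Real.exp (m * s / k - 1) := by
    have h1 : m * s / k ≤ Real.exp (m * s / k - 1) := by
      linarith [Real.add_one_le_exp (m * s / k - 1)]
    calc s = (k : ℝ) / m * (m * s / k) := by field_simp
      _ ≤ _ := by gcongr
  calc s ^ k ≤ ((k : ℝ) / m * Real.exp (m * s / k - 1)) ^ k := by gcongr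
    _ = _ := by
      rw [mul_pow, ← Real.exp_nat_mul]
      congr 2
      field_simp

/-- The frequency `k / m` maximizes the binomial likelihood. -/
lemma pow_mul_pow_le {m k : ℕ} (hm : 0 < m) (hk : k ≤ m) {s : ℝ} (h0 : 0 ≤ s) (h1 : s ≤ 1) :
    s ^ k * (1 - s) ^ (m - k) ≤ ((k : ℝ) / m) ^ k * (1 - (k : ℝ) / m) ^ (m - k) := by
  have hm' : (m : ℝ) ≠ 0 := by positivity
  have a := pow_le_div_pow_mul_exp hm k h0
  have b := pow_le_div_pow_mul_exp hm (m - k) (sub_nonneg.mpr h1)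
  have e : ((m - k : ℕ) : ℝ) / m = 1 - (k : ℝ) / m := by
    rw [Nat.cast_sub hk]; field_simp
  rw [e, Nat.cast_sub hk] at b
  have h2 : (0 : ℝ) ≤ 1 - s := by linarith
  calc _ ≤ (((k : ℝ) / m) ^ k * Real.exp (m * s - k)) *
        ((1 - (k : ℝ) / m) ^ (m - k) * Real.exp (m * (1 - s) - (m - k))) :=
      mul_le_mul a b (by positivity) (by positivity)
    _ = ((k : ℝ) / m) ^ k * (1 - (k : ℝ) / m) ^ (m - k) *
        Real.exp ((m * s - k) + (m * (1 - s) - (m - k))) := by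
      rw [Real.exp_add]; ring
    _ = _ := by
      rw [show (m * s - k : ℝ) + (m * (1 - s) - (m - k)) = 0 by ring]; simp

lemma exp_mul_log_div {s p r : ℝ} (hs : 0 ≤ s) (hp : 0 < p) :
    Real.exp (r * (s * Real.log (s / p))) = (s / p) ^ (r * s) := by
  rcases hs.eq_or_lt with rfl | hs
  · simp
  · rw [Real.rpow_def_of_pos (by positivity)]
    congr 1; ring

lemma mean_mem_Icc {m : ℕ} (hm : 0 < m) {x : Fin m → ℝ}
    (hx : ∀ k, x k ∈ Set.Icc (0 : ℝ) 1) : (m : ℝ)⁻¹ * ∑ k, x k ∈ Set.Icc (0 : ℝ) 1 := by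
  have hm' : (0 : ℝ) < m := by positivity
  refine ⟨mul_nonneg (by positivity) (Finset.sum_nonneg fun k _ => (hx k).1), ?_⟩
  rw [inv_mul_le_one₀ hm']
  exact (Finset.sum_le_sum fun k _ => (hx k).2).trans (by simp)

lemma exp_klBin_mean_le_prod {m : ℕ} (hm : 0 < m) {p : ℝ} (hp0 : 0 < p) (hp1 : p < 1)
    {x : Fin m → ℝ} (hx : ∀ k, x k ∈ Set.Icc (0 : ℝ) 1) {s : ℝ} (hs : s = (m : ℝ)⁻¹ * ∑ k, x k) :
    Real.exp (m * klBin s p) ≤ ∏ k, (x k * (s / p) + (1 - x k) * ((1 - s) / (1 - p))) := by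
  have hm' : (m : ℝ) ≠ 0 := by positivity
  have hsum : ∑ k, x k = m * s := by rw [hs]; field_simp
  have hsum' : ∑ k, (1 - x k) = m * (1 - s) := by
    rw [Finset.sum_sub_distrib, hsum]; simp; ring
  obtain ⟨hs0, hs1⟩ : 0 ≤ s ∧ 0 ≤ 1 - s := by
    rw [sub_nonneg, hs]; exact mean_mem_Icc hm hx
  have hp1' : 0 < 1 - p := by linarith
  have hA : 0 ≤ s / p := by positivity
  have hB : 0 ≤ (1 - s) / (1 - p) := by positivity
  rw [klBin, mul_add, Real.exp_add, exp_mul_log_div hs0 hp0, exp_mul_log_div hs1 hp1', ← hsum,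
    ← hsum', Real.rpow_sum_of_nonneg hA fun k _ => (hx k).1,
    Real.rpow_sum_of_nonneg hB fun k _ => sub_nonneg.mpr (hx k).2, ← Finset.prod_mul_distrib]
  refine Finset.prod_le_prod (fun k _ => by positivity) fun k _ => ?_
  exact Real.geom_mean_le_arith_mean2_weighted (hx k).1 (sub_nonneg.mpr (hx k).2) hA hB (by ring)

/-- `exp (m * kl(·‖p))` at the mean of points of the unit interval is at most its expectation
at the mean of independent Bernoulli variables with these points as parameters. -/
lemma exp_klBin_mean_le_sum {m : ℕ} (hm : 0 < m) {p : ℝ} (hp0 : 0 < p) (hp1 : p < 1)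
    {x : Fin m → ℝ} (hx : ∀ k, x k ∈ Set.Icc (0 : ℝ) 1) :
    Real.exp (m * klBin ((m : ℝ)⁻¹ * ∑ k, x k) p) ≤
      ∑ t : Finset (Fin m), (((t.card : ℝ) / m) ^ t.card *
        (1 - (t.card : ℝ) / m) ^ (m - t.card) / (p ^ t.card * (1 - p) ^ (m - t.card))) *
        ∏ k, (if k ∈ t then x k else 1 - x k) := by
  set s := (m : ℝ)⁻¹ * ∑ k, x k with hs
  obtain ⟨hs0, hs1⟩ : s ∈ Set.Icc (0 : ℝ) 1 := mean_mem_Icc hm hx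
  refine (exp_klBin_mean_le_prod hm hp0 hp1 hx hs).trans ?_
  rw [Finset.prod_add, Finset.powerset_univ]
  refine Finset.sum_le_sum fun t _ => ?_
  have hc : (Finset.univ \ t).card = m - t.card := by
    rw [Finset.card_sdiff_of_subset (Finset.subset_univ t)]; simp
  have ht : t.card ≤ m := by simpa using Finset.card_le_univ t
  have hprod : ∏ k, (if k ∈ t then x k else 1 - x k) =
      (∏ k ∈ t, x k) * ∏ k ∈ Finset.univ \ t, (1 - x k) := by
    rw [Finset.prod_ite]
    congr 2 <;> ext <;> simp
  rw [Finset.prod_mul_distrib, Finset.prod_mul_distrib, Finset.prod_const, Finset.prod_const, hc,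
    div_pow, div_pow, hprod]
  have hp1' : 0 < 1 - p := by linarith
  have h0 : 0 ≤ (∏ k ∈ t, x k) * ∏ k ∈ Finset.univ \ t, (1 - x k) :=
    mul_nonneg (Finset.prod_nonneg fun k _ => (hx k).1)
      (Finset.prod_nonneg fun k _ => sub_nonneg.mpr (hx k).2)
  calc _ = (s ^ t.card * (1 - s) ^ (m - t.card) / (p ^ t.card * (1 - p) ^ (m - t.card))) *
        ((∏ k ∈ t, x k) * ∏ k ∈ Finset.univ \ t, (1 - x k)) := by
        field_simp
    _ ≤ _ := by
      refine mul_le_mul_of_nonneg_right ?_ h0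
      exact div_le_div_of_nonneg_right (pow_mul_pow_le hm ht hs0 hs1) (by positivity)

lemma integrable_of_ae_mem_Icc {Z : Type*} [MeasurableSpace Z] {D : Measure Z}
    [IsFiniteMeasure D] {h : Z → ℝ} (hh : Measurable h)
    (h01 : ∀ᵐ z ∂D, h z ∈ Set.Icc (0 : ℝ) 1) : Integrable h D := by
  refine Integrable.of_bound hh.aestronglyMeasurable 1 ?_
  filter_upwards [h01] with z hz
  rw [Real.norm_eq_abs, abs_le]
  exact ⟨by linarith [hz.1], hz.2⟩

/-- Maurer's lemma for `[0,1]`-valued variables whose mean is neither `0` nor `1`. -/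
lemma lintegral_exp_klBin_mean_le {Z : Type*} [MeasurableSpace Z] (D : Measure Z)
    [IsProbabilityMeasure D] {h : Z → ℝ} (hh : Measurable h)
    (h01 : ∀ᵐ z ∂D, h z ∈ Set.Icc (0 : ℝ) 1) {m : ℕ} (hm : 0 < m)
    (hp0 : 0 < ∫ z, h z ∂D) (hp1 : ∫ z, h z ∂D < 1) :
    ∫⁻ S, ENNReal.ofReal (Real.exp (m * klBin ((m : ℝ)⁻¹ * ∑ k, h (S k)) (∫ z, h z ∂D)))
      ∂(Measure.pi fun _ : Fin m => D) ≤ ENNReal.ofReal (xi m) := by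
  set p := ∫ z, h z ∂D with hp
  set w : ℕ → ℝ := fun j => ((j : ℝ) / m) ^ j * (1 - (j : ℝ) / m) ^ (m - j) /
    (p ^ j * (1 - p) ^ (m - j)) with hw
  have hint : Integrable h D := integrable_of_ae_mem_Icc hh h01
  have hae : ∀ᵐ S ∂(Measure.pi fun _ : Fin m => D), ∀ k, h (S k) ∈ Set.Icc (0 : ℝ) 1 :=
    ae_all_iff.mpr fun k =>
      (measurePreserving_eval (fun _ : Fin m => D) k).quasiMeasurePreserving.ae h01
  have hfac (t : Finset (Fin m)) (k : Fin m) :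
      Integrable (fun z => if k ∈ t then h z else 1 - h z) D := by
    split_ifs
    · exact hint
    · exact (integrable_const 1).sub hint
  have hterm (t : Finset (Fin m)) : Integrable (fun S : Fin m → Z =>
      w t.card * ∏ k, (if k ∈ t then h (S k) else 1 - h (S k)))
      (Measure.pi fun _ : Fin m => D) :=
    (Integrable.fintype_prod (f := fun k z => if k ∈ t then h z else 1 - h z)
      (hfac t)).const_mul _
  calc _ ≤ ∫⁻ S, ENNReal.ofReal (∑ t : Finset (Fin m), w t.card *
          ∏ k, (if k ∈ t then h (S k) else 1 - h (S k))) ∂(Measure.pi fun _ : Fin m => D) := by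
        refine lintegral_mono_ae ?_
        filter_upwards [hae] with S hS
        exact ENNReal.ofReal_le_ofReal (exp_klBin_mean_le_sum hm hp0 hp1 hS)
    _ = ENNReal.ofReal (∫ S, ∑ t : Finset (Fin m), w t.card *
          ∏ k, (if k ∈ t then h (S k) else 1 - h (S k)) ∂(Measure.pi fun _ : Fin m => D)) := by
        rw [ofReal_integral_eq_lintegral_ofReal (integrable_finsetSum _ fun t _ => hterm t)]
        filter_upwards [hae] with S hS
        exact (Real.exp_pos _).le.trans (exp_klBin_mean_le_sum hm hp0 hp1 hS)
    _ = _ := by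
        congr 1
        rw [integral_finsetSum _ fun t _ => hterm t]
        have hval (t : Finset (Fin m)) : ∫ S : Fin m → Z, w t.card *
            ∏ k, (if k ∈ t then h (S k) else 1 - h (S k)) ∂(Measure.pi fun _ : Fin m => D) =
            ((t.card : ℝ) / m) ^ t.card * (1 - (t.card : ℝ) / m) ^ (m - t.card) := by
          have hk (k : Fin m) : ∫ z, (if k ∈ t then h z else 1 - h z) ∂D =
              if k ∈ t then p else 1 - p := by
            split_ifs
            · rfl
            · rw [integral_sub (integrable_const 1) hint]; simp [hp]
          rw [integral_const_mul,
            integral_fintype_prod_eq_prod (f := fun k z => if k ∈ t then h z else 1 - h z)]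
          simp_rw [hk]
          rw [Finset.prod_ite, Finset.prod_const, Finset.prod_const]
          have e1 : (Finset.univ.filter (· ∈ t)).card = t.card := by simp
          have e2 : (Finset.univ.filter (· ∉ t)).card = m - t.card := by
            rw [Finset.filter_not, Finset.card_sdiff_of_subset (Finset.filter_subset _ _)]; simp
          rw [e1, e2, hw]
          have hp1' : 0 < 1 - p := by linarith
          field_simp
        simp_rw [hval]
        rw [← Finset.powerset_univ, Finset.sum_powerset_apply_card
          (fun j => ((j : ℝ) / m) ^ j * (1 - (j : ℝ) / m) ^ (m - j))]
        simp [xi, mul_assoc]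

/-- Maurer's lemma for `[0,1]`-valued variables. -/
lemma lintegral_expKl_mean_le {Z : Type*} [MeasurableSpace Z] (D : Measure Z)
    [IsProbabilityMeasure D] {h : Z → ℝ} (hh : Measurable h)
    (h01 : ∀ᵐ z ∂D, h z ∈ Set.Icc (0 : ℝ) 1) {m : ℕ} (hm : 0 < m) :
    ∫⁻ S, expKl m ((m : ℝ)⁻¹ * ∑ k, h (S k)) (∫ z, h z ∂D) ∂(Measure.pi fun _ : Fin m => D) ≤
      ENNReal.ofReal (xi m) := by
  have hm' : (m : ℝ) ≠ 0 := by positivity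
  have hint : Integrable h D := integrable_of_ae_mem_Icc hh h01
  have hp0 : 0 ≤ ∫ z, h z ∂D := integral_nonneg_of_ae (h01.mono fun z hz => hz.1)
  have hp1 : 0 ≤ ∫ z, (1 - h z) ∂D :=
    integral_nonneg_of_ae (h01.mono fun z hz => sub_nonneg.mpr hz.2)
  have hsub : ∫ z, (1 - h z) ∂D = 1 - ∫ z, h z ∂D := by
    rw [integral_sub (integrable_const 1) hint]; simp
  have hconst (r : ℝ) (hr : r = 0 ∨ r = 1) (hp : ∫ z, h z ∂D = r) (hz : ∀ᵐ z ∂D, h z = r) :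
      ∫⁻ S, expKl m ((m : ℝ)⁻¹ * ∑ k, h (S k)) (∫ z, h z ∂D) ∂(Measure.pi fun _ : Fin m => D) ≤
      ENNReal.ofReal (xi m) := by
    have hae : ∀ᵐ S ∂(Measure.pi fun _ : Fin m => D), ∀ k, h (S k) = r :=
      ae_all_iff.mpr fun k =>
        (measurePreserving_eval (fun _ : Fin m => D) k).quasiMeasurePreserving.ae hz
    calc _ ≤ ∫⁻ _, 1 ∂(Measure.pi fun _ : Fin m => D) := by
          refine lintegral_mono_ae ?_
          filter_upwards [hae] with S hS
          rcases hr with rfl | rfl <;> simp [hS, hp, expKl, klBin, hm']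
      _ ≤ _ := by simpa using one_le_xi hm
  rcases hp0.eq_or_lt with hp | hp0
  · refine hconst 0 (Or.inl rfl) hp.symm ?_
    exact (integral_eq_zero_iff_of_nonneg_ae (h01.mono fun z hz => hz.1) hint).mp hp.symm
  rcases hp1.eq_or_lt with hp | hp1
  · refine hconst 1 (Or.inr rfl) (by linarith) ?_
    have := (integral_eq_zero_iff_of_nonneg_ae (h01.mono fun z hz => sub_nonneg.mpr hz.2)
      ((integrable_const 1).sub hint)).mp hp.symm
    filter_upwards [this] with z hz
    simp only [Pi.zero_apply] at hz
    linarith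
  rw [hsub] at hp1
  refine le_of_eq_of_le (lintegral_congr fun S => ?_)
    (lintegral_exp_klBin_mean_le D hh h01 hm hp0 (by linarith))
  rw [expKl, if_neg]
  rintro (h | h) <;> linarith [h.1]

/-- Under an expectation, `a * log (a / b)` is minorized by a linear function of `(a, b)` that is
tight at the means (the log-sum inequality in tangent form). -/
lemma exists_linear_le_mul_log_div {ι : Type*} [MeasurableSpace ι] (Q : Measure ι)
    {a b : ι → ℝ} (ha : Integrable a Q) (hb : Integrable b Q) (ha0 : ∀ i, 0 ≤ a i)
    (hb0 : ∀ i, 0 ≤ b i) (hab : ∀ᵐ i ∂Q, b i = 0 → a i = 0) :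
    ∃ α β : ℝ, (∀ᵐ i ∂Q, α * a i + β * b i ≤ a i * Real.log (a i / b i)) ∧
      α * ∫ i, a i ∂Q + β * ∫ i, b i ∂Q =
        (∫ i, a i ∂Q) * Real.log ((∫ i, a i ∂Q) / ∫ i, b i ∂Q) := by
  set q := ∫ i, a i ∂Q with hq
  set p := ∫ i, b i ∂Q with hp
  have hq0 : 0 ≤ q := integral_nonneg ha0
  have hp0 : 0 ≤ p := integral_nonneg hb0
  by_cases hqz : q = 0
  · refine ⟨0, 0, ?_, by simp [hqz]⟩
    filter_upwards [(integral_eq_zero_iff_of_nonneg ha0 ha).mp hqz] with i hi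
    simp [hi]
  have hpz : p ≠ 0 := by
    intro h
    apply hqz
    refine integral_eq_zero_of_ae ?_
    filter_upwards [(integral_eq_zero_iff_of_nonneg hb0 hb).mp h, hab] with i hi hi'
    exact hi' hi
  have hq1 : 0 < q := lt_of_le_of_ne hq0 (Ne.symm hqz)
  have hp1 : 0 < p := lt_of_le_of_ne hp0 (Ne.symm hpz)
  refine ⟨Real.log (q / p) + 1, -(q / p), ?_, by field_simp; ring⟩
  filter_upwards [hab] with i hi
  rcases (ha0 i).eq_or_lt with h0 | h0
  · rw [← h0]
    have : 0 ≤ q / p * b i := mul_nonneg (by positivity) (hb0 i)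
    simpa using this
  have hbi : 0 < b i := lt_of_le_of_ne (hb0 i) fun h => h0.ne' (hi h.symm)
  have key := Real.one_sub_inv_le_log_of_pos (x := a i / b i / (q / p)) (by positivity)
  rw [Real.log_div (by positivity) (by positivity)] at key
  have h2 := mul_le_mul_of_nonneg_left key h0.le
  have e : a i * (1 - (a i / b i / (q / p))⁻¹) = a i - q / p * b i := by field_simp
  rw [e] at h2
  linarith

lemma ofReal_integral_le_lintegral_ofReal {ι : Type*} [MeasurableSpace ι] {Q : Measure ι}
    {f : ι → ℝ} (hf : Integrable f Q) :
    ENNReal.ofReal (∫ i, f i ∂Q) ≤ ∫⁻ i, ENNReal.ofReal (f i) ∂Q := by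
  refine ENNReal.ofReal_le_of_le_toReal ?_
  rw [integral_eq_lintegral_pos_part_sub_lintegral_neg_part hf]
  exact sub_le_self _ ENNReal.toReal_nonneg

/-- `kl` of the means is controlled by the exponential moment (joint convexity and Jensen). -/
lemma ofReal_exp_klBin_integral_le {ι : Type*} [MeasurableSpace ι] (Q : Measure ι)
    [IsProbabilityMeasure Q] {a b : ι → ℝ} (ha : Measurable a) (hb : Measurable b)
    (ha01 : ∀ i, a i ∈ Set.Icc (0 : ℝ) 1) (hb01 : ∀ i, b i ∈ Set.Icc (0 : ℝ) 1) (m : ℕ)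
    (hfin : ∫⁻ i, expKl m (a i) (b i) ∂Q ≠ ⊤) :
    ENNReal.ofReal (Real.exp (m * klBin (∫ i, a i ∂Q) (∫ i, b i ∂Q))) ≤
      ∫⁻ i, expKl m (a i) (b i) ∂Q := by
  have hai : Integrable a Q := integrable_of_ae_mem_Icc ha (.of_forall ha01)
  have hbi : Integrable b Q := integrable_of_ae_mem_Icc hb (.of_forall hb01)
  have hai' : Integrable (fun i => 1 - a i) Q := (integrable_const 1).sub hai
  have hbi' : Integrable (fun i => 1 - b i) Q := (integrable_const 1).sub hbi
  have hmeas : Measurable fun i => expKl m (a i) (b i) :=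
    (measurable_expKl m).comp (ha.prodMk hb)
  have hgood : ∀ᵐ i ∂Q, ¬ ((b i = 0 ∧ a i ≠ 0) ∨ (b i = 1 ∧ a i ≠ 1)) := by
    filter_upwards [ae_lt_top hmeas hfin] with i hi hbad
    rw [expKl, if_pos hbad] at hi
    exact lt_irrefl _ hi
  obtain ⟨α, β, hle, heq⟩ := exists_linear_le_mul_log_div Q hai hbi (fun i => (ha01 i).1)
    (fun i => (hb01 i).1) (hgood.mono fun i hi h => by tauto)
  obtain ⟨α', β', hle', heq'⟩ := exists_linear_le_mul_log_div Q hai' hbi'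
    (fun i => sub_nonneg.mpr (ha01 i).2) (fun i => sub_nonneg.mpr (hb01 i).2)
    (hgood.mono fun i hi h => by
      by_contra h'
      exact hi (Or.inr ⟨by linarith, fun h'' => h' (by linarith)⟩))
  have hone {f : ι → ℝ} (hf : Integrable f Q) : ∫ i, (1 - f i) ∂Q = 1 - ∫ i, f i ∂Q := by
    rw [integral_sub (integrable_const 1) hf]; simp
  set K := klBin (∫ i, a i ∂Q) (∫ i, b i ∂Q) with hK
  have h₁ : Integrable (fun i => α * a i + β * b i) Q := (hai.const_mul _).add (hbi.const_mul _)
  have h₂ : Integrable (fun i => α' * (1 - a i) + β' * (1 - b i)) Q :=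
    (hai'.const_mul _).add (hbi'.const_mul _)
  have hlin : Integrable (fun i => α * a i + β * b i + (α' * (1 - a i) + β' * (1 - b i))) Q :=
    h₁.add h₂
  have hL : ∫ i, (α * a i + β * b i + (α' * (1 - a i) + β' * (1 - b i))) ∂Q = K := by
    rw [integral_add h₁ h₂,
      integral_add (hai.const_mul _) (hbi.const_mul _),
      integral_add (hai'.const_mul _) (hbi'.const_mul _), integral_const_mul,
      integral_const_mul, integral_const_mul, integral_const_mul, heq, heq', hone hai, hone hbi,
      hK, klBin]
  set L := fun i => α * a i + β * b i + (α' * (1 - a i) + β' * (1 - b i)) with hLdef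
  have hT : Integrable (fun i => Real.exp (m * K) * (1 - m * K + m * L i)) Q :=
    ((integrable_const _).add (hlin.const_mul _)).const_mul _
  have hTval : ∫ i, Real.exp (m * K) * (1 - m * K + m * L i) ∂Q = Real.exp (m * K) := by
    rw [integral_const_mul, integral_add (integrable_const _) (hlin.const_mul _),
      integral_const_mul, hL]
    simp
  rw [← hTval]
  refine (ofReal_integral_le_lintegral_ofReal hT).trans (lintegral_mono_ae ?_)
  filter_upwards [hgood, hle, hle'] with i hi h1 h2
  rw [expKl, if_neg hi]
  refine ENNReal.ofReal_le_ofReal ?_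
  have h3 : (m : ℝ) * L i ≤ m * klBin (a i) (b i) := by
    gcongr
    simp only [klBin, L]
    linarith
  calc Real.exp (m * K) * (1 - m * K + m * L i)
      ≤ Real.exp (m * K) * Real.exp (m * L i - m * K) := by
        gcongr
        linarith [Real.add_one_le_exp (m * L i - m * K)]
    _ = Real.exp (m * L i) := by rw [← Real.exp_add]; congr 1; ring
    _ ≤ _ := Real.exp_le_exp.mpr h3

/-- Posteriors aligned on the prior integrate complement-invariant functions like the prior. -/
lemma lintegral_eq_of_aligned {ι : Type*} [MeasurableSpace ι] {c : ι → ι} (hc : Measurable c)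
    {P Q : Measure ι} (hQ : Q + Measure.map c Q = P + Measure.map c P) {g : ι → ENNReal}
    (hg : Measurable g) (hgc : ∀ i, g (c i) = g i) : ∫⁻ i, g i ∂Q = ∫⁻ i, g i ∂P := by
  have h := congrArg (fun μ => ∫⁻ i, g i ∂μ) hQ
  simp only [lintegral_add_measure, lintegral_map hg hc, hgc, ← two_mul] at h
  exact (ENNReal.mul_right_inj (by simp) (by simp)).mp h

/-- Markov's inequality in confidence form. -/
lemma meas_ofReal_div_le {Ω : Type*} [MeasurableSpace Ω] {μ : Measure Ω} {Z : Ω → ENNReal}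
    (hZ : Measurable Z) {r δ : ℝ} (hr : 0 < r) (hδ : 0 < δ)
    (h : ∫⁻ ω, Z ω ∂μ ≤ ENNReal.ofReal r) :
    μ {ω | ENNReal.ofReal (r / δ) ≤ Z ω} ≤ ENNReal.ofReal δ := by
  have hrδ : 0 < r / δ := div_pos hr hδ
  have hne : ENNReal.ofReal (r / δ) ≠ 0 := (ENNReal.ofReal_pos.mpr hrδ).ne'
  refine (meas_ge_le_lintegral_div hZ.aemeasurable hne ENNReal.ofReal_ne_top).trans ?_
  calc _ ≤ ENNReal.ofReal r / ENNReal.ofReal (r / δ) := by gcongr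
    _ = ENNReal.ofReal δ := by rw [← ENNReal.ofReal_div_of_pos hrδ, div_div_cancel₀ (ne_of_gt hr)]

/-- PAC-Bayesian bound without KL term: for a self-complemented set of voters
(`F (c i) = -(F i)` with `c` a bijection), with probability at least `1 - δ` over
`S ∼ D^m`, simultaneously for all posteriors `Q` aligned on the prior `P`
(`Q + c_*Q = P + c_*P`), `kl(R_S(G_Q) ‖ R_D(G_Q)) ≤ (1/m)·ln(ξ(m)/δ)`. -/
theorem statement16 {X ι : Type*} [MeasurableSpace X] [MeasurableSpace ι]
    (D : Measure (X × ℝ)) [IsProbabilityMeasure D]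
    (hY : ∀ᵐ p ∂D, p.2 = 1 ∨ p.2 = -1)
    (F : ι → X → ℝ) (hF : ∀ i x, F i x ∈ Set.Icc (-1 : ℝ) 1)
    (hFmeas : Measurable fun q : ι × X => F q.1 q.2)
    (c : ι → ι) (hc_bij : Function.Bijective c) (hc_meas : Measurable c)
    (hc : ∀ i x, F (c i) x = -(F i x))
    (P : Measure ι) [IsProbabilityMeasure P]
    (δ : ℝ) (hδ : δ ∈ Set.Ioc (0 : ℝ) 1)
    (m : ℕ) (hm : 0 < m) :
    ENNReal.ofReal (1 - δ) ≤
      (Measure.pi fun _ : Fin m => D)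
        {S | ∀ Q : Measure ι, IsProbabilityMeasure Q →
          Q + Measure.map c Q = P + Measure.map c P →
          klBin (empGibbs F S Q) (trueGibbs F D Q) ≤
            (m : ℝ)⁻¹ * Real.log (xi m / δ)} := by
  have hL : Measurable fun q : ι × (X × ℝ) => linLoss (F q.1) q.2 := by
    have h : Measurable fun q : ι × (X × ℝ) => F q.1 q.2.1 :=
      hFmeas.comp (measurable_fst.prodMk (measurable_fst.comp measurable_snd))
    unfold linLoss
    fun_prop
  have hLi (i : ι) : Measurable (linLoss (F i)) := hL.comp measurable_prodMk_left
  have hLc (i : ι) (z : X × ℝ) : linLoss (F (c i)) z = 1 - linLoss (F i) z := by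
    simp only [linLoss, hc]; ring
  have hL01 {z : X × ℝ} (hz : z.2 = 1 ∨ z.2 = -1) (i : ι) :
      linLoss (F i) z ∈ Set.Icc (0 : ℝ) 1 := by
    have h := hF i z.1
    rw [Set.mem_Icc] at h
    rcases hz with hz | hz <;> simp only [linLoss, hz, Set.mem_Icc] <;> constructor <;> linarith
  have hL01ae (i : ι) : ∀ᵐ z ∂D, linLoss (F i) z ∈ Set.Icc (0 : ℝ) 1 :=
    hY.mono fun z hz => hL01 hz i
  have hLint (i : ι) : Integrable (linLoss (F i)) D := integrable_of_ae_mem_Icc (hLi i) (hL01ae i)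
  set b : ι → ℝ := fun i => ∫ z, linLoss (F i) z ∂D with hb_def
  set a : (Fin m → X × ℝ) → ι → ℝ := fun S i => (m : ℝ)⁻¹ * ∑ k, linLoss (F i) (S k) with ha_def
  have hm' : (m : ℝ) ≠ 0 := by positivity
  have hb : Measurable b := (hL.stronglyMeasurable.integral_prod_right (ν := D)).measurable
  have ha : Measurable fun q : (Fin m → X × ℝ) × ι => a q.1 q.2 := by
    refine measurable_const.mul (Finset.measurable_sum _ fun k _ => ?_)
    exact hL.comp (measurable_snd.prodMk ((measurable_pi_apply k).comp measurable_fst))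
  have hbc (i : ι) : b (c i) = 1 - b i := by
    simp only [hb_def, hLc]
    rw [integral_sub (integrable_const 1) (hLint i)]; simp
  have hac (S : Fin m → X × ℝ) (i : ι) : a S (c i) = 1 - a S i := by
    simp only [ha_def, hLc, Finset.sum_sub_distrib]
    simp [mul_sub, hm']
  have hb01 (i : ι) : b i ∈ Set.Icc (0 : ℝ) 1 := by
    refine ⟨integral_nonneg_of_ae ((hL01ae i).mono fun z hz => hz.1), ?_⟩
    calc b i ≤ ∫ _, (1 : ℝ) ∂D :=
          integral_mono_ae (hLint i) (integrable_const 1) ((hL01ae i).mono fun z hz => hz.2)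
      _ = 1 := by simp
  have hg : Measurable fun q : (Fin m → X × ℝ) × ι => expKl m (a q.1 q.2) (b q.2) :=
    (measurable_expKl m).comp (ha.prodMk (hb.comp measurable_snd))
  set μ := Measure.pi fun _ : Fin m => D with hμ
  set Z : (Fin m → X × ℝ) → ENNReal := fun S => ∫⁻ i, expKl m (a S i) (b i) ∂P with hZ_def
  have hZ : Measurable Z := hg.lintegral_prod_right'
  have hZint : ∫⁻ S, Z S ∂μ ≤ ENNReal.ofReal (xi m) := by
    rw [lintegral_lintegral_swap hg.aemeasurable]
    calc _ ≤ ∫⁻ _, ENNReal.ofReal (xi m) ∂P :=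
          lintegral_mono fun i => lintegral_expKl_mean_le D (hLi i) (hL01ae i) hm
      _ = _ := by simp
  have hxi : 0 < xi m := zero_lt_one.trans_le (one_le_xi hm)
  have hr : 0 < xi m / δ := div_pos hxi hδ.1
  have hmarkov : μ {S | ENNReal.ofReal (xi m / δ) ≤ Z S} ≤ ENNReal.ofReal δ :=
    meas_ofReal_div_le hZ hxi hδ.1 hZint
  have hlow : ENNReal.ofReal (1 - δ) ≤ μ {S | ENNReal.ofReal (xi m / δ) ≤ Z S}ᶜ := by
    rw [prob_compl_eq_one_sub (measurableSet_le measurable_const hZ),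
      ENNReal.ofReal_sub _ hδ.1.le, ENNReal.ofReal_one]
    exact tsub_le_tsub_left hmarkov 1
  have hS : ∀ᵐ S ∂μ, ∀ k, (S k).2 = 1 ∨ (S k).2 = -1 :=
    ae_all_iff.mpr fun k =>
      (measurePreserving_eval (fun _ : Fin m => D) k).quasiMeasurePreserving.ae hY
  refine hlow.trans (measure_mono_ae (hS.mono fun S hS hSZ => ?_))
  intro Q hQ hQP
  have hSZ : Z S < ENNReal.ofReal (xi m / δ) := not_le.mp hSZ
  have haS : Measurable (a S) := by
    refine measurable_const.mul (Finset.measurable_sum _ fun k _ => ?_)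
    exact hL.comp (measurable_id.prodMk measurable_const)
  have haS01 (i : ι) : a S i ∈ Set.Icc (0 : ℝ) 1 :=
    mean_mem_Icc hm fun k => hL01 (hS k) i
  have hgS : Measurable fun i => expKl m (a S i) (b i) :=
    (measurable_expKl m).comp (haS.prodMk hb)
  have hQZ : ∫⁻ i, expKl m (a S i) (b i) ∂Q = Z S :=
    lintegral_eq_of_aligned hc_meas hQP hgS fun i => by
      simp only [hac, hbc, expKl_one_sub]
  have key := ofReal_exp_klBin_integral_le Q haS hb haS01 hb01 m (hQZ ▸ hSZ.ne_top)
  rw [hQZ] at key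
  have hexp := (ENNReal.ofReal_le_ofReal_iff hr.le).mp (key.trans hSZ.le)
  rw [← Real.le_log_iff_exp_le hr] at hexp
  change klBin (∫ i, a S i ∂Q) (∫ i, b i ∂Q) ≤ _
  rw [← div_eq_inv_mul, le_div_iff₀' (by positivity)]
  exact hexp
end

section
/- Let H = {f_1,…,f_{2n}} be a finite self-complemented set of voters, let S be a finite training sample (with its uniform empirical distribution), and let μ ∈ (0,1]. For every quasi-uniform distribution Q on H whose empirical margin satisfies μ1(M_Q^S) ≥ μ, there exists a quasi-uniform distribution Q' on H with E_{f∼Q'} f(x) = (μ/μ1(M_Q^S))·E_{f∼Q} f(x) for all x ∈ X. Consequently μ1(M_{Q'}^S) = μ, the majority votes coincide (B_{Q'} = B_Q), and for every distribution D' on X × {-1,1} with μ2(M_Q^{D'}) > 0 the C-bound values coincide: 1 − μ1(M_{Q'}^{D'})²/μ2(M_{Q'}^{D'}) = 1 − μ1(M_Q^{D'})²/μ2(M_Q^{D'}); in particular the empirical and true C-bound values of Q' equal those of Q. -/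
open MeasureTheory

/-- The output `E_{f∼Q} f(x)` of the `Q`-weighted vote over the finite
self-complemented set of voters `{F (i,false), F (i,true) = -F (i,false)}`. -/
noncomputable def voteSum {X : Type*} {n : ℕ} (F : Fin n × Bool → X → ℝ)
    (Q : Fin n × Bool → ℝ) (x : X) : ℝ :=
  ∑ j, Q j * F j x

/-- Empirical first moment of the margin on the sample `S`. -/
noncomputable def empMu1 {X : Type*} {n m : ℕ} (F : Fin n × Bool → X → ℝ)
    (Q : Fin n × Bool → ℝ) (S : Fin m → X × ℝ) : ℝ :=
  (m : ℝ)⁻¹ * ∑ k, (S k).2 * voteSum F Q (S k).1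

/-- Empirical second moment of the margin on the sample `S`. -/
noncomputable def empMu2 {X : Type*} {n m : ℕ} (F : Fin n × Bool → X → ℝ)
    (Q : Fin n × Bool → ℝ) (S : Fin m → X × ℝ) : ℝ :=
  (m : ℝ)⁻¹ * ∑ k, ((S k).2 * voteSum F Q (S k).1) ^ 2

/-- First moment of the margin `M_Q(x,y) = y·E_{f∼Q} f(x)` under `D'`. -/
noncomputable def trueMu1 {X : Type*} [MeasurableSpace X] {n : ℕ}
    (F : Fin n × Bool → X → ℝ) (Q : Fin n × Bool → ℝ) (D' : Measure (X × ℝ)) : ℝ :=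
  ∫ p, p.2 * voteSum F Q p.1 ∂D'

/-- Second moment of the margin under `D'`. -/
noncomputable def trueMu2 {X : Type*} [MeasurableSpace X] {n : ℕ}
    (F : Fin n × Bool → X → ℝ) (Q : Fin n × Bool → ℝ) (D' : Measure (X × ℝ)) : ℝ :=
  ∫ p, (p.2 * voteSum F Q p.1) ^ 2 ∂D'

/-- Shrinking a weighting of a self-complemented set towards the uniform one. -/
noncomputable def shrinkWeight {n : ℕ} (c : ℝ) (Q : Fin n × Bool → ℝ) (j : Fin n × Bool) : ℝ :=
  c * Q j + (1 - c) / (2 * n)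

lemma voteSum_shrinkWeight {X : Type*} {n : ℕ} {F : Fin n × Bool → X → ℝ}
    (hcompl : ∀ (i : Fin n) (x : X), F (i, true) x = -(F (i, false) x))
    (c : ℝ) (Q : Fin n × Bool → ℝ) (x : X) :
    voteSum F (shrinkWeight c Q) x = c * voteSum F Q x := by
  simp only [voteSum, shrinkWeight, Fintype.sum_prod_type, Fintype.sum_bool, hcompl,
    Finset.mul_sum]
  exact Finset.sum_congr rfl fun i _ => by ring

lemma shrinkWeight_add {n : ℕ} {Q : Fin n × Bool → ℝ} {i : Fin n}
    (hQu : Q (i, false) + Q (i, true) = 1 / (n : ℝ)) (c : ℝ) :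
    shrinkWeight c Q (i, false) + shrinkWeight c Q (i, true) = 1 / (n : ℝ) := by
  have h : shrinkWeight c Q (i, false) + shrinkWeight c Q (i, true)
      = c * (Q (i, false) + Q (i, true)) + (1 - c) * (1 / n) := by
    simp only [shrinkWeight]
    ring
  rw [h, hQu]
  ring

lemma sum_eq_one_of_quasiUniform {n : ℕ} (hn : 0 < n) {Q : Fin n × Bool → ℝ}
    (hQu : ∀ i : Fin n, Q (i, false) + Q (i, true) = 1 / (n : ℝ)) : ∑ j, Q j = 1 := by
  have hn' : (n : ℝ) ≠ 0 := by positivity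
  simp only [Fintype.sum_prod_type, Fintype.sum_bool]
  simp [add_comm (Q (_, true)), hQu, hn']

section Scaling

variable {X : Type*} {n : ℕ} {F : Fin n × Bool → X → ℝ} {Q Q' : Fin n × Bool → ℝ} {c : ℝ}

lemma empMu1_of_voteSum_eq_mul {m : ℕ} (h : ∀ x, voteSum F Q' x = c * voteSum F Q x)
    (S : Fin m → X × ℝ) : empMu1 F Q' S = c * empMu1 F Q S := by
  simp only [empMu1, h, mul_left_comm _ c, ← Finset.mul_sum]

lemma empMu2_of_voteSum_eq_mul {m : ℕ} (h : ∀ x, voteSum F Q' x = c * voteSum F Q x)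
    (S : Fin m → X × ℝ) : empMu2 F Q' S = c ^ 2 * empMu2 F Q S := by
  simp only [empMu2, h, mul_left_comm _ c, mul_pow c, ← Finset.mul_sum, mul_left_comm _ (c ^ 2)]

lemma trueMu1_of_voteSum_eq_mul [MeasurableSpace X]
    (h : ∀ x, voteSum F Q' x = c * voteSum F Q x) (D' : Measure (X × ℝ)) :
    trueMu1 F Q' D' = c * trueMu1 F Q D' := by
  simp only [trueMu1, h, mul_left_comm _ c, integral_const_mul]

lemma trueMu2_of_voteSum_eq_mul [MeasurableSpace X]
    (h : ∀ x, voteSum F Q' x = c * voteSum F Q x) (D' : Measure (X × ℝ)) :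
    trueMu2 F Q' D' = c ^ 2 * trueMu2 F Q D' := by
  simp only [trueMu2, h, mul_left_comm _ c, mul_pow c, integral_const_mul]

end Scaling

lemma Real.sign_mul_of_pos {c : ℝ} (hc : 0 < c) (r : ℝ) :
    Real.sign (c * r) = Real.sign r := by
  rcases lt_trichotomy r 0 with h | rfl | h
  · rw [Real.sign_of_neg h, Real.sign_of_neg (mul_neg_of_pos_of_neg hc h)]
  · rw [mul_zero]
  · rw [Real.sign_of_pos h, Real.sign_of_pos (mul_pos hc h)]

/-- For every quasi-uniform `Q` with empirical margin `μ₁(M_Q^S) ≥ μ > 0` there is a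
quasi-uniform `Q'` whose vote output is `(μ/μ₁(M_Q^S))` times that of `Q`; hence
`μ₁(M_{Q'}^S) = μ`, the majority votes coincide, and the (empirical and true) C-bound
values of `Q'` equal those of `Q`. -/
theorem statement19 {X : Type*} [MeasurableSpace X] (n : ℕ) (hn : 0 < n)
    (F : Fin n × Bool → X → ℝ) (hF : ∀ j x, F j x ∈ Set.Icc (-1 : ℝ) 1)
    (hcompl : ∀ (i : Fin n) (x : X), F (i, true) x = -(F (i, false) x))
    (m : ℕ) (hm : 0 < m) (S : Fin m → X × ℝ)
    (hS : ∀ k, (S k).2 = 1 ∨ (S k).2 = -1)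
    (μ : ℝ) (hμ : μ ∈ Set.Ioc (0 : ℝ) 1)
    (Q : Fin n × Bool → ℝ) (hQ0 : ∀ j, 0 ≤ Q j) (hQ1 : ∑ j, Q j = 1)
    (hQu : ∀ i : Fin n, Q (i, false) + Q (i, true) = 1 / (n : ℝ))
    (hmargin : μ ≤ empMu1 F Q S) :
    ∃ Q' : Fin n × Bool → ℝ,
      (∀ j, 0 ≤ Q' j) ∧ (∑ j, Q' j = 1) ∧
      (∀ i : Fin n, Q' (i, false) + Q' (i, true) = 1 / (n : ℝ)) ∧
      (∀ x, voteSum F Q' x = (μ / empMu1 F Q S) * voteSum F Q x) ∧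
      empMu1 F Q' S = μ ∧
      (∀ x, Real.sign (voteSum F Q' x) = Real.sign (voteSum F Q x)) ∧
      (0 < empMu2 F Q S →
        1 - (empMu1 F Q' S) ^ 2 / empMu2 F Q' S
          = 1 - (empMu1 F Q S) ^ 2 / empMu2 F Q S) ∧
      (∀ D' : Measure (X × ℝ), IsProbabilityMeasure D' →
        (∀ᵐ p ∂D', p.2 = 1 ∨ p.2 = -1) →
        0 < trueMu2 F Q D' →
        1 - (trueMu1 F Q' D') ^ 2 / trueMu2 F Q' D'
          = 1 - (trueMu1 F Q D') ^ 2 / trueMu2 F Q D') := by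
  have hμ0 : 0 < μ := hμ.1
  have hM : 0 < empMu1 F Q S := hμ0.trans_le hmargin
  set c := μ / empMu1 F Q S with hc
  have hc0 : 0 < c := div_pos hμ0 hM
  have hc1 : c ≤ 1 := (div_le_one hM).2 hmargin
  have hvote := voteSum_shrinkWeight hcompl c Q
  have hquasi := fun i => shrinkWeight_add (hQu i) c
  have hcancel : ∀ a b : ℝ, (c * a) ^ 2 / (c ^ 2 * b) = a ^ 2 / b := fun a b => by
    rw [mul_pow, mul_div_mul_left _ _ (pow_ne_zero 2 hc0.ne')]
  refine ⟨shrinkWeight c Q, fun j => ?_, sum_eq_one_of_quasiUniform hn hquasi, hquasi, hvote,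
    ?_, fun x => ?_, fun _ => ?_, fun D' _ _ _ => ?_⟩
  · exact add_nonneg (mul_nonneg hc0.le (hQ0 j)) (div_nonneg (sub_nonneg.2 hc1) (by positivity))
  · rw [empMu1_of_voteSum_eq_mul hvote, hc, div_mul_cancel₀ _ hM.ne']
  · rw [hvote, Real.sign_mul_of_pos hc0]
  · rw [empMu1_of_voteSum_eq_mul hvote, empMu2_of_voteSum_eq_mul hvote, hcancel]
  · rw [trueMu1_of_voteSum_eq_mul hvote, trueMu2_of_voteSum_eq_mul hvote, hcancel]
end
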